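/- Let L1 = [[1,0],[1,1]], R1 = [[1,1],[0,1]], L2 = [[1,0],[1,0]], and R2 = [[0,1],[0,1]] be 2×2 natural-number matrices. Let A and B each be the product of a finite list of matrices drawn from {L1, R1, L2, R2}. Then both entries of the vector (A·(R1·L1·R1·L1)·B) applied to the column vector (1,1) are at least 2. Consequently, any tunnel whose corridor configuration sequence contains the consecutive block L_1, R_1, L_1, R_1 has more than one minimal giant step construction; in particular, tunnels with a unique minimal giant step construction are sparse. -/

import Mathlib

/-- The transfer matrix `L1 = [[1,0],[1,1]]`. -/
def L1 : Matrix (Fin 2) (Fin 2) ℕ := !![1, 0; 1, 1]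

/-- The transfer matrix `R1 = [[1,1],[0,1]]`. -/
def R1 : Matrix (Fin 2) (Fin 2) ℕ := !![1, 1; 0, 1]

/-- The transfer matrix `L2 = [[1,0],[1,0]]`. -/
def L2 : Matrix (Fin 2) (Fin 2) ℕ := !![1, 0; 1, 0]

/-- The transfer matrix `R2 = [[0,1],[0,1]]`. -/
def R2 : Matrix (Fin 2) (Fin 2) ℕ := !![0, 1; 0, 1]

/-- A product of the transfer matrices preserves every uniform entrywise lower bound on a vector. -/
theorem le_list_prod_mulVec (c : ℕ) (v : Fin 2 → ℕ) (hv : ∀ i, c ≤ v i)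
    (Ms : List (Matrix (Fin 2) (Fin 2) ℕ))
    (hM : ∀ M ∈ Ms, M = L1 ∨ M = R1 ∨ M = L2 ∨ M = R2) :
    ∀ i, c ≤ Ms.prod.mulVec v i := by
  induction Ms with
  | nil => simpa using hv
  | cons M Ms ih =>
    have hw := ih fun N hN => hM N (List.mem_cons_of_mem _ hN)
    rw [List.prod_cons, ← Matrix.mulVec_mulVec]
    generalize Ms.prod.mulVec v = w at hw
    have h₀ := hw 0
    have h₁ := hw 1
    intro i
    rcases hM M List.mem_cons_self with rfl | rfl | rfl | rfl <;> fin_cases i <;>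
      simp [L1, R1, L2, R2, Matrix.mulVec, dotProduct, Fin.sum_univ_two] <;> omega

/-- The block `R1 * L1 * R1 * L1` sends vectors with positive entries to vectors with entries
at least `2`. -/
theorem two_le_block_mulVec (v : Fin 2 → ℕ) (hv : ∀ i, 1 ≤ v i) :
    ∀ i, 2 ≤ (R1 * L1 * R1 * L1).mulVec v i := by
  have h₀ := hv 0
  have h₁ := hv 1
  intro i
  fin_cases i <;>
    simp [L1, R1, Matrix.mulVec, dotProduct, Fin.sum_univ_two] <;> omega

/-- If `A` and `B` are each products of finite lists of matrices drawn from
`{L1, R1, L2, R2}`, then both entries of `(A·(R1·L1·R1·L1)·B)` applied to the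
column vector `(1,1)` are at least `2`.  Hence any tunnel whose corridor
configuration sequence contains the consecutive block `L_1, R_1, L_1, R_1`
has more than one minimal giant step construction. -/
theorem giant_steps_not_unique_of_block (As Bs : List (Matrix (Fin 2) (Fin 2) ℕ))
    (hA : ∀ M ∈ As, M = L1 ∨ M = R1 ∨ M = L2 ∨ M = R2)
    (hB : ∀ M ∈ Bs, M = L1 ∨ M = R1 ∨ M = L2 ∨ M = R2) :
    ∀ i : Fin 2,
      2 ≤ (As.prod * (R1 * L1 * R1 * L1) * Bs.prod).mulVec ![1, 1] i := by
  rw [← Matrix.mulVec_mulVec, ← Matrix.mulVec_mulVec]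
  refine le_list_prod_mulVec 2 _ (two_le_block_mulVec _ ?_) As hA
  refine le_list_prod_mulVec 1 _ (fun i => ?_) Bs hB
  fin_cases i <;> simp
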